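/- Let a20, a11, a10, a01, a00 be smooth real functions on ℝ². Set q = a11/2, r = a20, I₁₀ = a10 − (a11·a20 + 2·∂_x a20) and I₀₁ = a01 − (a11²/4 + (∂_x a11)/2). Then there exists a smooth function s : ℝ² → ℝ such that for every smooth u : ℝ² → ℝ: ∂_x∂_x∂_y u + a20·∂_x∂_x u + a11·∂_x∂_y u + a10·∂_x u + a01·∂_y u + a00·u = (∂_x + q)((∂_x + q)((∂_y + r)u)) + I₁₀·∂_x u + I₀₁·∂_y u + s·u, where (∂_x + f)v denotes ∂_x v + f·v and (∂_y + f)v denotes ∂_y v + f·v. -/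

import Mathlib

noncomputable def dx (f : (Fin 2 → ℝ) → ℝ) : (Fin 2 → ℝ) → ℝ :=
  fun p => fderiv ℝ f p (Pi.single 0 1)

noncomputable def dy (f : (Fin 2 → ℝ) → ℝ) : (Fin 2 → ℝ) → ℝ :=
  fun p => fderiv ℝ f p (Pi.single 1 1)

theorem ContDiff.dx {f : (Fin 2 → ℝ) → ℝ} (hf : ContDiff ℝ (⊤ : ℕ∞) f) :
    ContDiff ℝ (⊤ : ℕ∞) (dx f) :=
  (hf.fderiv_right (m := (⊤ : ℕ∞)) le_rfl).clm_apply contDiff_const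

theorem ContDiff.dy {f : (Fin 2 → ℝ) → ℝ} (hf : ContDiff ℝ (⊤ : ℕ∞) f) :
    ContDiff ℝ (⊤ : ℕ∞) (dy f) :=
  (hf.fderiv_right (m := (⊤ : ℕ∞)) le_rfl).clm_apply contDiff_const

theorem dx_add {f g : (Fin 2 → ℝ) → ℝ} (hf : ContDiff ℝ (⊤ : ℕ∞) f)
    (hg : ContDiff ℝ (⊤ : ℕ∞) g) : dx (fun y => f y + g y) = fun y => dx f y + dx g y := by
  funext y
  simp only [dx]
  rw [fderiv_fun_add (hf.differentiable (by simp) y) (hg.differentiable (by simp) y)]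
  rfl

theorem dx_mul {f g : (Fin 2 → ℝ) → ℝ} (hf : ContDiff ℝ (⊤ : ℕ∞) f)
    (hg : ContDiff ℝ (⊤ : ℕ∞) g) :
    dx (fun y => f y * g y) = fun y => dx f y * g y + f y * dx g y := by
  funext y
  simp only [dx]
  rw [fderiv_fun_mul (hf.differentiable (by simp) y) (hg.differentiable (by simp) y)]
  simp only [_root_.add_apply, _root_.smul_apply, smul_eq_mul]
  ring

theorem dx_div_const {f : (Fin 2 → ℝ) → ℝ} (hf : ContDiff ℝ (⊤ : ℕ∞) f) (c : ℝ) :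
    dx (fun y => f y / c) = fun y => dx f y / c := by
  have hc : dx (fun _ => c⁻¹) = fun _ => 0 := by
    funext y
    simp [dx]
  simp only [div_eq_mul_inv]
  rw [dx_mul hf contDiff_const, hc]
  simp

theorem incomplete_factorization_xxy
    (a20 a11 a10 a01 a00 : (Fin 2 → ℝ) → ℝ)
    (h20 : ContDiff ℝ (⊤ : ℕ∞) a20) (h11 : ContDiff ℝ (⊤ : ℕ∞) a11) (h10 : ContDiff ℝ (⊤ : ℕ∞) a10)
    (h01 : ContDiff ℝ (⊤ : ℕ∞) a01) (h00 : ContDiff ℝ (⊤ : ℕ∞) a00) :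
    ∃ s : (Fin 2 → ℝ) → ℝ, ContDiff ℝ (⊤ : ℕ∞) s ∧
      ∀ u : (Fin 2 → ℝ) → ℝ, ContDiff ℝ (⊤ : ℕ∞) u → ∀ x,
        dx (dx (dy u)) x + a20 x * dx (dx u) x + a11 x * dx (dy u) x
          + a10 x * dx u x + a01 x * dy u x + a00 x * u x =
        (let q : (Fin 2 → ℝ) → ℝ := fun y => a11 y / 2
         let r : (Fin 2 → ℝ) → ℝ := a20
         let w1 : (Fin 2 → ℝ) → ℝ := fun y => dy u y + r y * u y
         let w2 : (Fin 2 → ℝ) → ℝ := fun y => dx w1 y + q y * w1 y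
         dx w2 x + q x * w2 x)
          + (a10 x - (a11 x * a20 x + 2 * dx a20 x)) * dx u x
          + (a01 x - ((a11 x) ^ 2 / 4 + dx a11 x / 2)) * dy u x
          + s x * u x := by
  have hq : ContDiff ℝ (⊤ : ℕ∞) fun y => a11 y / 2 := h11.div_const 2
  refine ⟨fun x => a00 x - (dx (dx a20) x + a11 x * dx a20 x
    + (dx a11 x / 2 + a11 x ^ 2 / 4) * a20 x), ?_, fun u hu x => ?_⟩
  · exact h00.sub ((h20.dx.dx.add (h11.mul h20.dx)).add
      (((h11.dx.div_const 2).add ((h11.pow 2).div_const 4)).mul h20))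
  · have hw : ContDiff ℝ (⊤ : ℕ∞) fun y => dy u y + a20 y * u y := hu.dy.add (h20.mul hu)
    have hdw : dx (fun y => dy u y + a20 y * u y)
        = fun y => dx (dy u) y + (dx a20 y * u y + a20 y * dx u y) := by
      rw [dx_add hu.dy (h20.mul hu), dx_mul h20 hu]
    have hddw : dx (dx fun y => dy u y + a20 y * u y) = fun y => dx (dx (dy u)) y
        + ((dx (dx a20) y * u y + dx a20 y * dx u y)
          + (dx a20 y * dx u y + a20 y * dx (dx u) y)) := by
      rw [hdw, dx_add hu.dy.dx ((h20.dx.mul hu).add (h20.mul hu.dx)),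
        dx_add (h20.dx.mul hu) (h20.mul hu.dx), dx_mul h20.dx hu, dx_mul h20 hu.dx]
    dsimp only
    rw [dx_add hw.dx (hq.mul hw), dx_mul hq hw, hddw, hdw, dx_div_const h11]
    ring
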